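/- Let E be a separable Banach space and let (Ω, ℱ, P) be a probability space carrying E-valued random variables (ξ_i)_{i≥0} with E[‖ξ_i‖²] < ∞ for every i ≥ 0. Then there exist a probability space and E-valued random variables (η_i)_{i≥0} defined on it such that η_i has the same distribution as ξ_i for every i ≥ 0, and for every i ≥ 1 the L₂-Wasserstein distance is attained along this coupling: d₂(law(ξ_i), law(ξ_0)) = ( E[‖η_i − η_0‖²] )^{1/2}. -/

import Mathlib

/-!
For Borel probability measures `ν ν'` with finite second moments on a separable Banach space
`E`, the `L₂`-Wasserstein distance is
  `d₂(ν,ν') = inf (∫ ‖u−v‖² dπ(u,v))^{1/2}`,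
the infimum being over couplings `π` of `ν` and `ν'`.

STATEMENT 17: given square-integrable `E`-valued random variables `(ξ_i)_{i≥0}` on a
probability space `(Ω,P)`, there are a probability space and random variables `(η_i)_{i≥0}`
with `η_i ∼ ξ_i` for every `i` and `d₂(law ξ_i, law ξ_0) = (E‖η_i − η_0‖²)^{1/2}` for `i ≥ 1`.
-/

open MeasureTheory Filter
open scoped ENNReal

/-- the `L₂`-Wasserstein (Mallows) distance between two measures on a normed space,
defined as the infimum over couplings of `(∫ ‖u−v‖² dπ)^{1/2}`. -/
noncomputable def wasserstein2 {E : Type*} [NormedAddCommGroup E] [MeasurableSpace E]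
    (ν ν' : Measure E) : ℝ :=
  sInf {c : ℝ | ∃ π : Measure (E × E), IsProbabilityMeasure π ∧
    π.map Prod.fst = ν ∧ π.map Prod.snd = ν' ∧
    c = Real.sqrt ((∫⁻ z : E × E, (‖z.1 - z.2‖₊ : ℝ≥0∞) ^ 2 ∂π).toReal)}


open ProbabilityTheory Topology

lemma cost_lsc {X : Type*} [NormedAddCommGroup X] [SecondCountableTopology X]
    [MeasurableSpace X] [BorelSpace X] :
    LowerSemicontinuous (fun π : ProbabilityMeasure (X × X) =>
      ∫⁻ z : X × X, (‖z.1 - z.2‖₊ : ℝ≥0∞) ^ 2 ∂(π : Measure (X × X))) := by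
  let g : ℕ → BoundedContinuousFunction (X × X) NNReal := fun n =>
    BoundedContinuousFunction.mkOfBound
      ⟨fun z => min (‖z.1 - z.2‖₊ ^ 2) (n : NNReal), by fun_prop⟩ n (by
        intro x y
        simp only [ContinuousMap.coe_mk, NNReal.dist_eq]
        rw [abs_le]
        have h1 : (min (‖x.1 - x.2‖₊ ^ 2) (n : NNReal) : NNReal) ≤ (n : NNReal) := min_le_right _ _
        have h2 : (min (‖y.1 - y.2‖₊ ^ 2) (n : NNReal) : NNReal) ≤ (n : NNReal) := min_le_right _ _
        have h1' : ((min (‖x.1 - x.2‖₊ ^ 2) (n : NNReal) : NNReal) : ℝ) ≤ n := by exact_mod_cast h1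
        have h2' : ((min (‖y.1 - y.2‖₊ ^ 2) (n : NNReal) : NNReal) : ℝ) ≤ n := by exact_mod_cast h2
        have h3 := (min (‖x.1 - x.2‖₊ ^ 2) (n : NNReal) : NNReal).coe_nonneg
        have h4 := (min (‖y.1 - y.2‖₊ ^ 2) (n : NNReal) : NNReal).coe_nonneg
        constructor <;> linarith)
  have hg : ∀ n z, g n z = min (‖z.1 - z.2‖₊ ^ 2) (n : NNReal) := fun n z => rfl
  have key : (fun π : ProbabilityMeasure (X × X) =>
      ∫⁻ z : X × X, (‖z.1 - z.2‖₊ : ℝ≥0∞) ^ 2 ∂(π : Measure (X × X))) =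
      fun π : ProbabilityMeasure (X × X) => ⨆ n, ∫⁻ z, (g n z : ℝ≥0∞) ∂(π : Measure (X × X)) := by
    funext π
    rw [← lintegral_iSup]
    · congr 1
      funext z
      apply le_antisymm
      · obtain ⟨n, hn⟩ := exists_nat_ge (‖z.1 - z.2‖₊ ^ 2)
        refine le_trans ?_ (le_iSup _ n)
        rw [hg, min_eq_left hn]
        push_cast
        exact le_rfl
      · refine iSup_le fun n => ?_
        rw [hg]
        exact_mod_cast min_le_left _ _
    · intro n
      exact (g n).continuous.measurable.coe_nnreal_ennreal
    · intro m n hmn z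
      simp only [hg]
      gcongr
  rw [key]
  exact lowerSemicontinuous_iSup fun n =>
    (ProbabilityMeasure.continuous_lintegral_boundedContinuousFunction (g n)).lowerSemicontinuous

lemma cost_lt_top {X : Type*} [NormedAddCommGroup X] [SecondCountableTopology X]
    [MeasurableSpace X] [BorelSpace X] (π : Measure (X × X))
    (h1 : ∫⁻ x, (‖x‖₊ : ℝ≥0∞) ^ 2 ∂(π.map Prod.fst) < ∞)
    (h2 : ∫⁻ x, (‖x‖₊ : ℝ≥0∞) ^ 2 ∂(π.map Prod.snd) < ∞) :
    ∫⁻ z : X × X, (‖z.1 - z.2‖₊ : ℝ≥0∞) ^ 2 ∂π < ∞ := by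
  rw [lintegral_map (by fun_prop) measurable_fst] at h1
  rw [lintegral_map (by fun_prop) measurable_snd] at h2
  have hle : ∀ z : X × X, (‖z.1 - z.2‖₊ : ℝ≥0∞) ^ 2 ≤
      2 * (‖z.1‖₊ : ℝ≥0∞) ^ 2 + 2 * (‖z.2‖₊ : ℝ≥0∞) ^ 2 := by
    intro z
    have : ‖z.1 - z.2‖₊ ^ 2 ≤ 2 * ‖z.1‖₊ ^ 2 + 2 * ‖z.2‖₊ ^ 2 := by
      rw [← NNReal.coe_le_coe]
      push_cast
      have := norm_sub_le z.1 z.2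
      nlinarith [sq_nonneg (‖z.1‖ - ‖z.2‖), norm_nonneg (z.1 - z.2)]
    exact_mod_cast this
  refine (lintegral_mono hle).trans_lt ?_
  rw [lintegral_add_left (by fun_prop), lintegral_const_mul _ (by fun_prop),
    lintegral_const_mul _ (by fun_prop)]
  exact ENNReal.add_lt_top.2 ⟨ENNReal.mul_lt_top (by simp) h1, ENNReal.mul_lt_top (by simp) h2⟩

lemma exists_optimal {X : Type*} [NormedAddCommGroup X] [CompleteSpace X]
    [SecondCountableTopology X] [MeasurableSpace X] [BorelSpace X]
    (μ ν : Measure X) [IsProbabilityMeasure μ] [IsProbabilityMeasure ν]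
    (h1 : ∫⁻ x, (‖x‖₊ : ℝ≥0∞) ^ 2 ∂μ < ∞)
    (h2 : ∫⁻ x, (‖x‖₊ : ℝ≥0∞) ^ 2 ∂ν < ∞) :
    ∃ π : Measure (X × X), IsProbabilityMeasure π ∧ π.map Prod.fst = μ ∧ π.map Prod.snd = ν ∧
      wasserstein2 μ ν = Real.sqrt ((∫⁻ z : X × X, (‖z.1 - z.2‖₊ : ℝ≥0∞) ^ 2 ∂π).toReal) := by
  let S : Set (ProbabilityMeasure (X × X)) :=
    {π | (π : Measure (X × X)).map Prod.fst = μ ∧ (π : Measure (X × X)).map Prod.snd = ν}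
  have hne : S.Nonempty := ⟨⟨μ.prod ν, inferInstance⟩, by simp [S, Measure.map_fst_prod], by simp [S, Measure.map_snd_prod]⟩
  have hclosed : IsClosed S := by
    have e : S = (fun π : ProbabilityMeasure (X × X) => π.map (measurable_fst (α := X) (β := X)).aemeasurable) ⁻¹' {⟨μ, inferInstance⟩} ∩
        (fun π : ProbabilityMeasure (X × X) => π.map (measurable_snd (α := X) (β := X)).aemeasurable) ⁻¹' {⟨ν, inferInstance⟩} := by
      ext π
      refine and_congr ?_ ?_
      · exact (Subtype.ext_iff (a1 := π.map (measurable_fst (α := X) (β := X)).aemeasurable)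
          (a2 := ⟨μ, inferInstance⟩)).symm
      · exact (Subtype.ext_iff (a1 := π.map (measurable_snd (α := X) (β := X)).aemeasurable)
          (a2 := ⟨ν, inferInstance⟩)).symm
    rw [e]
    exact (isClosed_singleton.preimage (ProbabilityMeasure.continuous_map continuous_fst)).inter
      (isClosed_singleton.preimage (ProbabilityMeasure.continuous_map continuous_snd))
  have htight : IsTightMeasureSet {((π : ProbabilityMeasure (X × X)) : Measure (X × X)) | π ∈ S} := by
    apply IsTightMeasureSet.prodMk
    · refine (isTightMeasureSet_singleton (μ := μ)).subset ?_
      rintro _ ⟨_, ⟨π, hπ, rfl⟩, rfl⟩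
      exact hπ.1
    · refine (isTightMeasureSet_singleton (μ := ν)).subset ?_
      rintro _ ⟨_, ⟨π, hπ, rfl⟩, rfl⟩
      exact hπ.2
  have hcomp : IsCompact S := by
    have := isCompact_closure_of_isTightMeasureSet htight
    rwa [hclosed.closure_eq] at this
  obtain ⟨π, hπ, hmin⟩ := (cost_lsc (X := X)).lowerSemicontinuousOn S |>.exists_isMinOn hne hcomp
  refine ⟨π, inferInstance, hπ.1, hπ.2, ?_⟩
  refine IsLeast.csInf_eq ⟨⟨π, inferInstance, hπ.1, hπ.2, rfl⟩, ?_⟩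
  rintro c ⟨ρ, hρ, hρ1, hρ2, rfl⟩
  apply Real.sqrt_le_sqrt
  apply ENNReal.toReal_mono
  · exact (cost_lt_top ρ (by rwa [hρ1]) (by rwa [hρ2])).ne
  · exact hmin (show (⟨ρ, hρ⟩ : ProbabilityMeasure (X × X)) ∈ S from ⟨hρ1, hρ2⟩)

/-- a coupling realised by randomisation of the second coordinate. -/
lemma exists_repr {X : Type*} [Nonempty X] [MeasurableSpace X] [StandardBorelSpace X]
    (μ ν : Measure X) (π : Measure (X × X)) [IsProbabilityMeasure π]
    (h1 : π.map Prod.fst = μ) (h2 : π.map Prod.snd = ν)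
    (f0 : unitInterval → X) (hf0 : Measurable f0) (hf0' : (volume : Measure unitInterval).map f0 = ν) :
    ∃ g : unitInterval × unitInterval → X, Measurable g ∧
      ((volume : Measure unitInterval).prod volume).map (fun w => (g w, f0 w.1)) = π := by
  let ρ : Measure (X × X) := π.map Prod.swap
  have hρ : IsProbabilityMeasure ρ := Measure.isProbabilityMeasure_map measurable_swap.aemeasurable
  have hfst : ρ.fst = ν := by
    rw [← h2, Measure.fst, Measure.map_map measurable_fst measurable_swap]
    rfl
  obtain ⟨f, hf, hfk⟩ := Kernel.exists_measurable_map_eq_unitInterval ρ.condKernel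
  have hg : Measurable (fun w : unitInterval × unitInterval => f (f0 w.1) w.2) :=
    hf.comp ((hf0.comp measurable_fst).prodMk measurable_snd)
  refine ⟨fun w => f (f0 w.1) w.2, hg, ?_⟩
  have key : ((volume : Measure unitInterval).prod volume).map
      (fun w => (f0 w.1, f (f0 w.1) w.2)) = ρ := by
    rw [← ρ.disintegrate ρ.condKernel, hfst, ← hf0']
    ext s hs
    have hm : Measurable (fun w : unitInterval × unitInterval => (f0 w.1, f (f0 w.1) w.2)) :=
      (hf0.comp measurable_fst).prodMk hg
    rw [Measure.map_apply hm hs, Measure.prod_apply (hm hs), Measure.compProd_apply hs,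
      lintegral_map (Kernel.measurable_kernel_prodMk_left hs) hf0]
    congr 1
    funext a
    rw [← hfk, Measure.map_apply (show Measurable (f (f0 a)) from hf.comp measurable_prodMk_left) (measurable_prodMk_left hs)]
    rfl
  have : π = ρ.map Prod.swap := by
    simp only [ρ]
    rw [Measure.map_map measurable_swap measurable_swap]
    simp
  rw [this, ← key, Measure.map_map measurable_swap
    (show Measurable (fun w : unitInterval × unitInterval => (f0 w.1, f (f0 w.1) w.2)) from
      (hf0.comp measurable_fst).prodMk hg)]
  rfl

theorem stmt17 {E : Type*} [NormedAddCommGroup E] [NormedSpace ℝ E] [CompleteSpace E]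
    [TopologicalSpace.SeparableSpace E] [MeasurableSpace E] [BorelSpace E]
    {Ω : Type} [MeasurableSpace Ω] (P : Measure Ω) [IsProbabilityMeasure P]
    (ξ : ℕ → Ω → E) (hmeas : ∀ i, Measurable (ξ i))
    (hL2 : ∀ i, (∫⁻ ω, (‖ξ i ω‖₊ : ℝ≥0∞) ^ 2 ∂P) < ∞) :
    ∃ (Ω' : Type) (_ : MeasurableSpace Ω') (P' : Measure Ω') (η : ℕ → Ω' → E),
      IsProbabilityMeasure P' ∧ (∀ i, Measurable (η i)) ∧
      (∀ i, Measure.map (η i) P' = Measure.map (ξ i) P) ∧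
      ∀ i, 1 ≤ i →
        wasserstein2 (Measure.map (ξ i) P) (Measure.map (ξ 0) P)
          = Real.sqrt ((∫⁻ ω', (‖η i ω' - η 0 ω'‖₊ : ℝ≥0∞) ^ 2 ∂P').toReal) := by
  haveI : SecondCountableTopology E := UniformSpace.secondCountable_of_separable E
  have hp : ∀ i, IsProbabilityMeasure (P.map (ξ i)) := fun i =>
    Measure.isProbabilityMeasure_map (hmeas i).aemeasurable
  have hm2 : ∀ i, ∫⁻ x, (‖x‖₊ : ℝ≥0∞) ^ 2 ∂(P.map (ξ i)) < ∞ := fun i => by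
    rw [lintegral_map (by fun_prop) (hmeas i)]
    exact hL2 i
  choose π hπ hπ1 hπ2 hπw using fun i =>
    exists_optimal (P.map (ξ i)) (P.map (ξ 0)) (hm2 i) (hm2 0)
  obtain ⟨f0, hf0, hf0'⟩ := Measure.exists_measurable_map_eq (P.map (ξ 0))
  choose g hg hgπ using fun i => exists_repr _ _ (π i) (hπ1 i) (hπ2 i) f0 hf0 hf0'
  have hf0m : Measurable (fun w : unitInterval × unitInterval => f0 w.1) := hf0.comp measurable_fst
  refine ⟨unitInterval × unitInterval, inferInstance, (volume : Measure unitInterval).prod volume,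
    fun i => if i = 0 then fun w => f0 w.1 else g i, inferInstance, ?_, ?_, ?_⟩
  · intro i
    by_cases hi : i = 0
    · simp only [hi, if_true]; exact hf0m
    · simp only [hi, if_false]; exact hg i
  · intro i
    by_cases hi : i = 0
    · simp only [hi, if_true]
      rw [← hπ2 0, ← hgπ 0, Measure.map_map measurable_snd ((hg 0).prodMk hf0m)]
      rfl
    · simp only [hi, if_false]
      rw [← hπ1 i]
      conv_rhs => rw [← hgπ i]
      rw [Measure.map_map measurable_fst ((hg i).prodMk hf0m)]
      rfl
  · intro i hi
    have hi0 : i ≠ 0 := by omega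
    simp only [hi0, if_false, if_true]
    rw [hπw i]
    conv_lhs => rw [← hgπ i]
    rw [lintegral_map (by fun_prop) ((hg i).prodMk hf0m)]
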